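/- Gronwall inequality in integral form with singular kernel: let u : [0,1] → [0,∞) be bounded and measurable and suppose u(t) ≤ a + ∫_0^t (t-s)^{-1/2} u(s) ds for all t ∈ [0,1], where a ≥ 0. Then sup_{t∈[0,1]} u(t) ≤ C·a for a universal constant C. -/

import Mathlib

open MeasureTheory Set in
/-- The kernel `r ^ (-1/2) * exp (-4πr)` is integrable on `(0, ∞)`. -/
theorem integrableOn_rpow_neg_half_mul_exp :
    IntegrableOn (fun r : ℝ => r ^ (-(1 : ℝ) / 2) * Real.exp (-(4 * Real.pi * r))) (Ioi 0) := by
  have h := integrableOn_rpow_mul_exp_neg_mul_rpow (p := 1) (s := -(1 : ℝ) / 2)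
    (b := 4 * Real.pi) (by norm_num) one_pos (by positivity)
  simpa using h

open MeasureTheory Set in
/-- The kernel `r ^ (-1/2) * exp (-4πr)` has total mass `1/2` on `(0, ∞)`. -/
theorem integral_rpow_neg_half_mul_exp :
    ∫ r in Ioi (0 : ℝ), r ^ (-(1 : ℝ) / 2) * Real.exp (-(4 * Real.pi * r)) = 1 / 2 := by
  have h := Real.integral_rpow_mul_exp_neg_mul_Ioi (a := 1 / 2) (r := 4 * Real.pi)
    (by norm_num) (by positivity)
  rw [show (1 : ℝ) / 2 - 1 = -(1 : ℝ) / 2 by norm_num] at h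
  rw [h, Real.Gamma_one_half_eq, ← Real.sqrt_eq_rpow, ← Real.sqrt_mul (by positivity),
    show 1 / (4 * Real.pi) * Real.pi = (1 / 2) ^ 2 by field_simp; norm_num,
    Real.sqrt_sq (by norm_num)]

open MeasureTheory Set in
/-- Integrating against the kernel `(t - s) ^ (-1/2)` halves the weighted bound
`u s ≤ K * exp (4πs)`. -/
theorem integral_singular_kernel_le {u : ℝ → ℝ} {K t : ℝ} (ht : 0 ≤ t) (hK : 0 ≤ K)
    (hu : ∀ s ∈ Icc 0 t, 0 ≤ u s)
    (huK : ∀ s ∈ Icc 0 t, u s ≤ K * Real.exp (4 * Real.pi * s)) :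
    ∫ s in (0 : ℝ)..t, (t - s) ^ (-(1 : ℝ) / 2) * u s
      ≤ K / 2 * Real.exp (4 * Real.pi * t) := by
  let k : ℝ → ℝ := fun r => r ^ (-(1 : ℝ) / 2) * Real.exp (-(4 * Real.pi * r))
  have hk : IntervalIntegrable k volume 0 t :=
    (intervalIntegrable_iff_integrableOn_Ioc_of_le ht).2
      (integrableOn_rpow_neg_half_mul_exp.mono_set Ioc_subset_Ioi_self)
  have hk' : IntervalIntegrable (fun s => k (t - s)) volume 0 t := by
    simpa using (hk.comp_sub_left t).symm
  have hmass : ∫ r in (0 : ℝ)..t, k r ≤ 1 / 2 := by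
    rw [← integral_rpow_neg_half_mul_exp, intervalIntegral.integral_of_le ht]
    refine setIntegral_mono_set integrableOn_rpow_neg_half_mul_exp ?_
      Ioc_subset_Ioi_self.eventuallyLE
    filter_upwards [ae_restrict_mem measurableSet_Ioi] with r hr
    have : (0 : ℝ) < r := hr
    simp only [Pi.zero_apply]
    positivity
  have hle : ∫ s in (0 : ℝ)..t, (t - s) ^ (-(1 : ℝ) / 2) * u s
      ≤ ∫ s in (0 : ℝ)..t, K * Real.exp (4 * Real.pi * t) * k (t - s) := by
    rw [intervalIntegral.integral_of_le ht, intervalIntegral.integral_of_le ht]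
    refine integral_mono_of_nonneg ?_
      ((intervalIntegrable_iff_integrableOn_Ioc_of_le ht).1 (hk'.const_mul _)) ?_
    · filter_upwards [ae_restrict_mem measurableSet_Ioc] with s hs
      exact mul_nonneg (Real.rpow_nonneg (sub_nonneg.2 hs.2) _) (hu s ⟨hs.1.le, hs.2⟩)
    · filter_upwards [ae_restrict_mem measurableSet_Ioc] with s hs
      have hexp : Real.exp (4 * Real.pi * s)
          = Real.exp (4 * Real.pi * t) * Real.exp (-(4 * Real.pi * (t - s))) := by
        rw [← Real.exp_add]
        ring_nf
      calc (t - s) ^ (-(1 : ℝ) / 2) * u s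
          ≤ (t - s) ^ (-(1 : ℝ) / 2) * (K * Real.exp (4 * Real.pi * s)) :=
            mul_le_mul_of_nonneg_left (huK s ⟨hs.1.le, hs.2⟩)
              (Real.rpow_nonneg (sub_nonneg.2 hs.2) _)
        _ = K * Real.exp (4 * Real.pi * t) * k (t - s) := by
            rw [hexp]
            ring
  calc _ ≤ _ := hle
    _ = K * Real.exp (4 * Real.pi * t) * ∫ r in (0 : ℝ)..t, k r := by
        rw [intervalIntegral.integral_const_mul, intervalIntegral.integral_comp_sub_left k t,
          sub_self, sub_zero]
    _ ≤ K * Real.exp (4 * Real.pi * t) * (1 / 2) := by gcongr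
    _ = K / 2 * Real.exp (4 * Real.pi * t) := by ring

/-- Gronwall inequality with singular kernel: there is a universal constant `C`
such that any bounded measurable `u ≥ 0` on `[0,1]` satisfying
`u(t) ≤ a + ∫_0^t (t-s)^{-1/2} u(s) ds` (with `a ≥ 0`) satisfies
`sup_{t∈[0,1]} u(t) ≤ C·a`. -/
theorem singular_gronwall :
    ∃ C : ℝ, 0 < C ∧
      ∀ (u : ℝ → ℝ) (a : ℝ), 0 ≤ a → Measurable u →
        (∀ t ∈ Set.Icc (0 : ℝ) 1, 0 ≤ u t) →
        (∃ M : ℝ, ∀ t ∈ Set.Icc (0 : ℝ) 1, u t ≤ M) →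
        (∀ t ∈ Set.Icc (0 : ℝ) 1,
          u t ≤ a + ∫ s in (0 : ℝ)..t, (t - s) ^ (-(1 : ℝ) / 2) * u s) →
        ∀ t ∈ Set.Icc (0 : ℝ) 1, u t ≤ C * a := by
  refine ⟨2 * Real.exp (4 * Real.pi), by positivity, ?_⟩
  rintro u a ha - hu ⟨M, hM⟩ hint
  let v : Set.Icc (0 : ℝ) 1 → ℝ := fun t => u t * Real.exp (-(4 * Real.pi * t))
  have hexp_le : ∀ t : Set.Icc (0 : ℝ) 1, Real.exp (-(4 * Real.pi * t)) ≤ 1 := fun t =>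
    Real.exp_le_one_iff.2 (neg_nonpos.2 (mul_nonneg (by positivity) t.2.1))
  have hbdd : BddAbove (Set.range v) := by
    refine ⟨M, ?_⟩
    rintro _ ⟨t, rfl⟩
    exact (mul_le_of_le_one_right (hu t t.2) (hexp_le t)).trans (hM t t.2)
  have hv : ∀ t, 0 ≤ v t := fun t => mul_nonneg (hu t t.2) (Real.exp_pos _).le
  have huK : ∀ t ∈ Set.Icc (0 : ℝ) 1, u t ≤ (⨆ t, v t) * Real.exp (4 * Real.pi * t) := by
    intro t ht
    have h : u t * Real.exp (-(4 * Real.pi * t)) ≤ ⨆ t, v t := le_ciSup hbdd ⟨t, ht⟩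
    rwa [Real.exp_neg, ← div_eq_mul_inv, div_le_iff₀ (Real.exp_pos _)] at h
  have hsup : ⨆ t, v t ≤ a + (⨆ t, v t) / 2 := by
    refine ciSup_le fun t => ?_
    have hsub : Set.Icc 0 (t : ℝ) ⊆ Set.Icc 0 1 := Set.Icc_subset_Icc_right t.2.2
    have h := (hint t t.2).trans (add_le_add_right (integral_singular_kernel_le t.2.1
      (Real.iSup_nonneg hv) (fun s hs => hu s (hsub hs)) fun s hs => huK s (hsub hs)) a)
    calc v t ≤ (a + (⨆ t, v t) / 2 * Real.exp (4 * Real.pi * t))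
          * Real.exp (-(4 * Real.pi * t)) := mul_le_mul_of_nonneg_right h (Real.exp_pos _).le
      _ = a * Real.exp (-(4 * Real.pi * t)) + (⨆ t, v t) / 2 := by
          rw [add_mul, mul_assoc (_ / 2), ← Real.exp_add, add_neg_cancel, Real.exp_zero, mul_one]
      _ ≤ a + (⨆ t, v t) / 2 := by
          gcongr
          exact mul_le_of_le_one_right ha (hexp_le t)
  intro t ht
  calc u t ≤ (⨆ t, v t) * Real.exp (4 * Real.pi * t) := huK t ht
    _ ≤ 2 * a * Real.exp (4 * Real.pi) :=
        mul_le_mul (by linarith)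
          (Real.exp_le_exp.2 (mul_le_of_le_one_right (by positivity) ht.2))
          (Real.exp_pos _).le (by positivity)
    _ = 2 * Real.exp (4 * Real.pi) * a := by ring
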